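/- Let α > 0 and ξ > 4 be real numbers. There exists N₀ = N₀(α, ξ) such that for all n ≥ N₀ the following holds: if G is a finite simple graph on n vertices with minimum degree δ(G) ≥ (1+α)·log₂ n and Cheeger constant Φ(G) > ξ·(log₂ log₂ n)/(log₂ n), then the number of orientations of G that are strongly connected is at least (1 − (1 + 4α·log₂ n)/(α·n^α·log₂ n))·2^{e(G)}, where e(G) is the number of edges of G. -/

import Mathlib

open Finset

variable {n : ℕ}

/-- `f e = true` means the edge `e` is directed from its smaller endpoint to its
larger endpoint. `dirAdj G f u v` says the orientation `f` directs an edge from `u` to `v`. -/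
def dirAdj (G : SimpleGraph (Fin n)) (f : G.edgeSet → Bool) (u v : Fin n) : Prop :=
  ∃ h : G.Adj u v, f ⟨s(u, v), (SimpleGraph.mem_edgeSet G).mpr h⟩ = decide (u < v)

/-- The oriented graph is strongly connected: every ordered pair of vertices is
joined by a directed path. -/
def IsStronglyConnected (G : SimpleGraph (Fin n)) (f : G.edgeSet → Bool) : Prop :=
  ∀ u v : Fin n, Relation.ReflTransGen (dirAdj G f) u v

/-- Probability of an event under a uniformly random orientation of `G`. -/
noncomputable def orientProb (G : SimpleGraph (Fin n)) [DecidableRel G.Adj]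
    (P : (G.edgeSet → Bool) → Prop) : ℝ :=
  ((@Finset.filter _ P (Classical.decPred _) Finset.univ).card : ℝ) /
    (Fintype.card (G.edgeSet → Bool) : ℝ)

/-- The volume of a vertex subset: the sum of the degrees of its vertices. -/
def vol (G : SimpleGraph (Fin n)) [DecidableRel G.Adj] (X : Finset (Fin n)) : ℕ :=
  ∑ v ∈ X, G.degree v

/-- `e(X, X̄)`: the number of edges of `G` with exactly one endpoint in `X`. -/
def crossCount (G : SimpleGraph (Fin n)) [DecidableRel G.Adj] (X : Finset (Fin n)) : ℕ :=
  ((X ×ˢ Xᶜ).filter fun p => G.Adj p.1 p.2).card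

/-- `X` is obtained from `A` by repeatedly adjoining neighbours. -/
def GrowsFrom {V : Type*} (G : SimpleGraph V) (A X : Finset V) : Prop :=
  A ⊆ X ∧ ∀ B, A ⊆ B → B ⊂ X → ∃ b ∈ B, ∃ u ∈ X, u ∉ B ∧ G.Adj b u

open Classical in
/-- The vertices outside `X` having a neighbour in `X`. -/
noncomputable def outerBoundary {V : Type*} [Fintype V] (G : SimpleGraph V) (X : Finset V) :
    Finset V :=
  univ.filter fun u => u ∉ X ∧ ∃ a ∈ X, G.Adj a u

open Classical in
/-- The site percolation bound: the events that the cluster of `A` is `X` are disjoint. -/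
theorem sum_growsFrom_le_one {V : Type*} [Fintype V] [DecidableEq V] (G : SimpleGraph V)
    (p : ℝ) (hp0 : 0 ≤ p) (hp1 : p ≤ 1) (A D : Finset V) :
    ∑ X with GrowsFrom G A X ∧ Disjoint X D,
      p ^ (X \ A).card * (1 - p) ^ (outerBoundary G X \ D).card ≤ 1 := by
  induction hm : ((A ∪ D)ᶜ).card using Nat.strong_induction_on generalizing A D with
  | _ m ih =>
  have hq0 : 0 ≤ 1 - p := by linarith
  by_cases hN : outerBoundary G A ⊆ D
  · calc _ ≤ ∑ X ∈ ({A} : Finset (Finset V)),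
          p ^ (X \ A).card * (1 - p) ^ (outerBoundary G X \ D).card := by
          apply sum_le_sum_of_subset_of_nonneg
          · intro X hX
            simp only [mem_filter, mem_univ, true_and] at hX
            obtain ⟨⟨hAX, hg⟩, hd⟩ := hX
            by_contra hne
            rw [mem_singleton] at hne
            obtain ⟨b, hb, u, hu, hub, hadj⟩ :=
              hg A subset_rfl (hAX.ssubset_of_ne (Ne.symm hne))
            have : u ∈ outerBoundary G A := by
              simp only [outerBoundary, mem_filter, mem_univ, true_and]
              exact ⟨hub, b, hb, hadj⟩
            exact (disjoint_left.mp hd) hu (hN this)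
          · intros; positivity
      _ ≤ 1 := by
          rw [sum_singleton, Finset.sdiff_self, card_empty, pow_zero, one_mul]
          exact pow_le_one₀ hq0 (by linarith)
  · obtain ⟨u, huA, huD⟩ := not_subset.mp hN
    simp only [outerBoundary, mem_filter, mem_univ, true_and] at huA
    obtain ⟨huA, a, ha, hau⟩ := huA
    have hlt1 : ((insert u A ∪ D)ᶜ).card < m := by
      rw [← hm]
      apply card_lt_card
      rw [ssubset_iff_of_subset (by intro z; simp +contextual)]
      exact ⟨u, by simp [huA, huD], by simp⟩
    have hlt2 : ((A ∪ insert u D)ᶜ).card < m := by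
      rw [← hm]
      apply card_lt_card
      rw [ssubset_iff_of_subset (by intro z; simp +contextual)]
      exact ⟨u, by simp [huA, huD], by simp⟩
    have h1 := ih _ hlt1 (insert u A) D rfl
    have h2 := ih _ hlt2 A (insert u D) rfl
    rw [← sum_filter_add_sum_filter_not _ (fun X => u ∈ X)]
    have e1 : ∑ X ∈ (univ.filter fun X => GrowsFrom G A X ∧ Disjoint X D).filter (fun X => u ∈ X),
        p ^ (X \ A).card * (1 - p) ^ (outerBoundary G X \ D).card ≤ p * 1 := by
      refine le_trans ?_ (mul_le_mul_of_nonneg_left h1 hp0)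
      rw [mul_sum]
      refine le_trans (sum_le_sum (g := fun X => p * (p ^ (X \ insert u A).card *
        (1 - p) ^ (outerBoundary G X \ D).card)) ?_)
        (sum_le_sum_of_subset_of_nonneg ?_ (by intros; positivity))
      · intro X hX
        simp only [mem_filter, mem_univ, true_and] at hX
        have : (X \ A).card = (X \ insert u A).card + 1 := by
          rw [sdiff_insert, card_erase_add_one (mem_sdiff.mpr ⟨hX.2, huA⟩)]
        rw [this, pow_succ]
        apply le_of_eq
        ring
      · intro X hX
        simp only [mem_filter, mem_univ, true_and] at hX ⊢
        obtain ⟨⟨⟨hAX, hg⟩, hd⟩, hu⟩ := hX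
        exact ⟨⟨insert_subset hu hAX, fun B hB => hg B ((subset_insert _ _).trans hB)⟩, hd⟩
    have e2 : ∑ X ∈ (univ.filter fun X => GrowsFrom G A X ∧ Disjoint X D).filter
        (fun X => ¬ u ∈ X),
        p ^ (X \ A).card * (1 - p) ^ (outerBoundary G X \ D).card ≤ (1 - p) * 1 := by
      refine le_trans ?_ (mul_le_mul_of_nonneg_left h2 hq0)
      rw [mul_sum]
      refine le_trans (sum_le_sum (g := fun X => (1 - p) * (p ^ (X \ A).card *
        (1 - p) ^ (outerBoundary G X \ insert u D).card)) ?_)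
        (sum_le_sum_of_subset_of_nonneg ?_ (by intros; positivity))
      · intro X hX
        simp only [mem_filter, mem_univ, true_and] at hX
        have hu : u ∈ outerBoundary G X := by
          simp only [outerBoundary, mem_filter, mem_univ, true_and]
          exact ⟨hX.2, a, hX.1.1.1 ha, hau⟩
        have : (outerBoundary G X \ D).card = (outerBoundary G X \ insert u D).card + 1 := by
          rw [sdiff_insert, card_erase_add_one (mem_sdiff.mpr ⟨hu, huD⟩)]
        rw [this, pow_succ]
        apply le_of_eq
        ring
      · intro X hX
        simp only [mem_filter, mem_univ, true_and] at hX ⊢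
        exact ⟨hX.1.1, disjoint_insert_right.mpr ⟨hX.2, hX.1.2⟩⟩
    linarith

theorem crossCount_compl (G : SimpleGraph (Fin n)) [DecidableRel G.Adj] (X : Finset (Fin n)) :
    crossCount G Xᶜ = crossCount G X := by
  unfold crossCount
  refine card_bij' (fun p _ => p.swap) (fun p _ => p.swap) ?_ ?_ (by simp) (by simp) <;>
  · intro p
    simp only [mem_filter, mem_product, mem_compl, Prod.fst_swap, Prod.snd_swap, G.adj_comm p.1]
    tauto

theorem vol_mono (G : SimpleGraph (Fin n)) [DecidableRel G.Adj] {X Y : Finset (Fin n)}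
    (h : X ⊆ Y) : vol G X ≤ vol G Y :=
  sum_le_sum_of_subset h

theorem card_mul_le_vol (G : SimpleGraph (Fin n)) [DecidableRel G.Adj] {d : ℝ}
    (hd : ∀ v, d ≤ G.degree v) (X : Finset (Fin n)) : X.card * d ≤ vol G X := by
  rw [vol, Nat.cast_sum, ← nsmul_eq_mul]
  exact card_nsmul_le_sum _ _ _ fun v _ => hd v

theorem card_outerBoundary_le (G : SimpleGraph (Fin n)) [DecidableRel G.Adj]
    (X : Finset (Fin n)) : (outerBoundary G X).card ≤ crossCount G X := by
  classical
  have : outerBoundary G X ⊆ ((X ×ˢ Xᶜ).filter fun p => G.Adj p.1 p.2).image Prod.snd := by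
    intro u hu
    simp only [outerBoundary, mem_filter, mem_univ, true_and] at hu
    obtain ⟨hu, a, ha, h⟩ := hu
    simp only [mem_image, mem_filter, mem_product, mem_compl]
    exact ⟨(a, u), ⟨⟨ha, hu⟩, h⟩, rfl⟩
  exact (card_le_card this).trans card_image_le

theorem card_mul_le_crossCount_add (G : SimpleGraph (Fin n)) [DecidableRel G.Adj] {d : ℝ}
    (hd : ∀ v, d ≤ G.degree v) (X : Finset (Fin n)) :
    X.card * d ≤ crossCount G X + X.card * (X.card - 1 : ℝ) := by
  classical
  have hdeg : ∀ v ∈ X, G.degree v + 1 ≤ (Xᶜ.filter fun u => G.Adj v u).card + X.card := by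
    intro v hv
    have hsub : insert v (G.neighborFinset v) ⊆ (Xᶜ.filter fun u => G.Adj v u) ∪ X := by
      intro u hu
      simp only [mem_insert, SimpleGraph.mem_neighborFinset] at hu
      simp only [mem_union, mem_filter, mem_compl]
      rcases hu with rfl | hu
      · exact Or.inr hv
      · tauto
    have := (card_le_card hsub).trans (card_union_le _ _)
    rwa [card_insert_of_notMem (by simp), SimpleGraph.card_neighborFinset_eq_degree] at this
  have hcross : crossCount G X = ∑ v ∈ X, (Xᶜ.filter fun u => G.Adj v u).card := by
    simp only [crossCount, card_filter, sum_product]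
  have hsum := sum_le_sum hdeg
  have hvol := card_mul_le_vol G hd X
  rw [sum_add_distrib, sum_add_distrib, ← hcross] at hsum
  have hsum' : (vol G X : ℝ) + X.card ≤ crossCount G X + X.card * X.card := by
    have : vol G X + X.card ≤ crossCount G X + X.card * X.card := by simpa [vol] using hsum
    exact_mod_cast this
  linarith

open Classical in
theorem card_orientations_closed (G : SimpleGraph (Fin n)) [DecidableRel G.Adj]
    (X : Finset (Fin n)) :
    ((univ.filter fun f : G.edgeSet → Bool => ∀ a ∈ X, ∀ b ∉ X, ¬ dirAdj G f a b).card : ℝ) ≤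
      2 ^ G.edgeFinset.card * (1 / 2) ^ crossCount G X := by
  let P : Finset (Fin n × Fin n) := (X ×ˢ Xᶜ).filter fun p => G.Adj p.1 p.2
  let B : Finset G.edgeSet := univ.filter fun e => ∃ p ∈ P, (e : Sym2 (Fin n)) = s(p.1, p.2)
  let t : G.edgeSet → Finset Bool := fun e =>
    univ.filter fun c => ∀ p ∈ P, (e : Sym2 (Fin n)) = s(p.1, p.2) → c ≠ decide (p.1 < p.2)
  have hB : crossCount G X ≤ B.card := by
    rw [crossCount, ← card_attach (s := (X ×ˢ Xᶜ).filter fun p => G.Adj p.1 p.2)]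
    refine card_le_card_of_injOn
      (fun p => ⟨s(p.1.1, p.1.2), (mem_filter.mp p.2).2⟩) ?_ ?_
    · intro p _
      exact mem_filter.mpr ⟨mem_univ _, p.1, p.2, rfl⟩
    · rintro ⟨⟨a, b⟩, h⟩ - ⟨⟨a', b'⟩, h'⟩ - heq
      simp only [mem_filter, mem_product, mem_compl] at h h'
      have heq' := Sym2.eq_iff.mp (Subtype.ext_iff.mp heq)
      grind
  have hsub : (univ.filter fun f : G.edgeSet → Bool => ∀ a ∈ X, ∀ b ∉ X, ¬ dirAdj G f a b) ⊆
      Fintype.piFinset t := by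
    intro f hf
    simp only [mem_filter, mem_univ, true_and] at hf
    simp only [Fintype.mem_piFinset, t, mem_filter, mem_univ, true_and]
    rintro ⟨e, he⟩ p hp rfl heq
    simp only [P, mem_filter, mem_product, mem_compl] at hp
    exact hf _ hp.1.1 _ hp.1.2 ⟨hp.2, heq⟩
  have hcard : (Fintype.piFinset t).card ≤ ∏ e : G.edgeSet, if e ∈ B then 1 else 2 := by
    rw [Fintype.card_piFinset]
    refine prod_le_prod' fun e _ => ?_
    split_ifs with he
    · obtain ⟨p, hp, hep⟩ := (mem_filter.mp he).2
      refine card_le_one.mpr fun c hc c' hc' => ?_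
      have h1 := (mem_filter.mp hc).2 p hp hep
      have h2 := (mem_filter.mp hc').2 p hp hep
      rw [Bool.eq_not_of_ne h1, Bool.eq_not_of_ne h2]
    · exact (card_le_univ _).trans (by simp)
  have hprod : (∏ e : G.edgeSet, if e ∈ B then 1 else 2) * 2 ^ B.card = 2 ^ G.edgeFinset.card := by
    have h : (2 : ℕ) ^ B.card = ∏ e : G.edgeSet, if e ∈ B then 2 else 1 := by
      rw [prod_ite_mem, univ_inter, prod_const]
    rw [h, ← prod_mul_distrib, prod_congr rfl (g := fun _ => 2)]
    · simp [SimpleGraph.edgeFinset_card]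
    · intro e _
      split_ifs <;> rfl
  have hle : (univ.filter fun f : G.edgeSet → Bool =>
      ∀ a ∈ X, ∀ b ∉ X, ¬ dirAdj G f a b).card * 2 ^ crossCount G X ≤ 2 ^ G.edgeFinset.card := by
    rw [← hprod]
    exact Nat.mul_le_mul ((card_le_card hsub).trans hcard) (Nat.pow_le_pow_right (by norm_num) hB)
  have hle' : ((univ.filter fun f : G.edgeSet → Bool =>
      ∀ a ∈ X, ∀ b ∉ X, ¬ dirAdj G f a b).card : ℝ) * 2 ^ crossCount G X ≤
        2 ^ G.edgeFinset.card := by exact_mod_cast hle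
  rw [one_div, inv_pow, ← div_eq_mul_inv, le_div_iff₀ (by positivity)]
  exact hle'

open Classical in
theorem growsFrom_reachable {G : SimpleGraph (Fin n)} {r : Fin n → Fin n → Prop}
    (hr : ∀ a b, r a b → G.Adj a b) (v : Fin n) :
    GrowsFrom G {v} (univ.filter fun u => Relation.ReflTransGen r v u) := by
  refine ⟨by simp [Relation.ReflTransGen.refl], fun B hvB hB => ?_⟩
  by_contra! h
  have hBX : ∀ u ∈ B, Relation.ReflTransGen r v u := fun u hu => by simpa using hB.1 hu
  apply hB.2
  intro u hu
  simp only [mem_filter, mem_univ, true_and] at hu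
  induction hu with
  | refl => simpa using hvB
  | @tail b c hvb hbc ih =>
    by_contra hc
    exact h b ih c (by simpa using hvb.tail hbc) hc (hr _ _ hbc)

/-- An orientation that is not strongly connected has a connected vertex set, of at most half the
total volume, whose boundary edges are all directed inwards or all directed outwards. -/
theorem exists_closed_of_not_stronglyConnected (G : SimpleGraph (Fin n)) [DecidableRel G.Adj]
    (f : G.edgeSet → Bool) (hf : ¬ IsStronglyConnected G f) :
    ∃ X : Finset (Fin n), (vol G X ≤ vol G Xᶜ ∧ ∃ v, GrowsFrom G {v} X) ∧
      ((∀ a ∈ X, ∀ b ∉ X, ¬ dirAdj G f a b) ∨ ∀ a ∈ Xᶜ, ∀ b ∉ Xᶜ, ¬ dirAdj G f a b) := by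
  classical
  by_contra! hcon
  apply hf
  intro u w
  let S : Finset (Fin n) := univ.filter fun x => Relation.ReflTransGen (dirAdj G f) u x
  let T : Finset (Fin n) :=
    univ.filter fun x => Relation.ReflTransGen (Function.swap (dirAdj G f)) w x
  have hS : vol G Sᶜ < vol G S := by
    by_contra! h
    obtain ⟨⟨a, ha, b, hb, hab⟩, -⟩ :=
      hcon S ⟨h, u, growsFrom_reachable (fun a b h => h.1) u⟩
    simp only [S, mem_filter, mem_univ, true_and] at ha hb
    exact hb (ha.tail hab)
  have hT : vol G Tᶜ < vol G T := by
    by_contra! h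
    obtain ⟨-, ⟨a, ha, b, hb, hab⟩⟩ :=
      hcon T ⟨h, w, growsFrom_reachable (fun a b h => h.1.symm) w⟩
    simp only [T, mem_compl, mem_filter, mem_univ, true_and, not_not] at ha hb
    exact ha (hb.tail hab)
  have hnd : ¬ Disjoint S T := by
    intro h
    have h1 := vol_mono G (le_compl_iff_disjoint_right.mpr h)
    have h2 := vol_mono G (le_compl_iff_disjoint_left.mpr h)
    omega
  obtain ⟨x, hxS, hxT⟩ := not_disjoint_iff.mp hnd
  simp only [S, T, mem_filter, mem_univ, true_and] at hxS hxT
  exact hxS.trans (Relation.reflTransGen_swap.mp hxT)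

open Classical in
theorem card_not_stronglyConnected_le (G : SimpleGraph (Fin n)) [DecidableRel G.Adj] :
    ((univ.filter fun f : G.edgeSet → Bool => ¬ IsStronglyConnected G f).card : ℝ) ≤
      2 ^ G.edgeFinset.card * (2 * ∑ X with vol G X ≤ vol G Xᶜ ∧ ∃ v, GrowsFrom G {v} X,
        (1 / 2 : ℝ) ^ crossCount G X) := by
  set F : Finset (Finset (Fin n)) :=
    univ.filter fun X => vol G X ≤ vol G Xᶜ ∧ ∃ v, GrowsFrom G {v} X
  let C : Finset (Fin n) → Finset (G.edgeSet → Bool) := fun X =>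
    univ.filter fun f => ∀ a ∈ X, ∀ b ∉ X, ¬ dirAdj G f a b
  have hsub : (univ.filter fun f : G.edgeSet → Bool => ¬ IsStronglyConnected G f) ⊆
      F.biUnion fun X => C X ∪ C Xᶜ := by
    intro f hf
    obtain ⟨X, hX, h⟩ := exists_closed_of_not_stronglyConnected G f (mem_filter.mp hf).2
    simp only [mem_biUnion, mem_union]
    exact ⟨X, mem_filter.mpr ⟨mem_univ _, hX⟩, h.imp (fun h => mem_filter.mpr ⟨mem_univ _, h⟩)
      (fun h => mem_filter.mpr ⟨mem_univ _, h⟩)⟩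
  calc _ ≤ ((F.biUnion fun X => C X ∪ C Xᶜ).card : ℝ) := by exact_mod_cast card_le_card hsub
    _ ≤ ∑ X ∈ F, ((C X ∪ C Xᶜ).card : ℝ) := by exact_mod_cast card_biUnion_le
    _ ≤ ∑ X ∈ F, 2 ^ G.edgeFinset.card * (2 * (1 / 2 : ℝ) ^ crossCount G X) := by
        refine sum_le_sum fun X _ => ?_
        have h1 := card_orientations_closed G X
        have h2 := card_orientations_closed G Xᶜ
        rw [crossCount_compl] at h2
        have h3 : ((C X ∪ C Xᶜ).card : ℝ) ≤ (C X).card + (C Xᶜ).card := by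
          exact_mod_cast card_union_le _ _
        change ((C X).card : ℝ) ≤ _ at h1
        change ((C Xᶜ).card : ℝ) ≤ _ at h2
        linarith
    _ = _ := by rw [← mul_sum, ← mul_sum]

open Classical in
theorem sum_half_pow_crossCount_le (G : SimpleGraph (Fin n)) [DecidableRel G.Adj]
    (F : Finset (Finset (Fin n))) (x₁ x ε : ℝ) (hx₁ : 0 ≤ x₁) (hx : 0 ≤ x) (hε : 0 ≤ ε)
    (hnx : n * x ≤ 1) (hF : ∀ X ∈ F, ∃ v, GrowsFrom G {v} X)
    (h : ∀ X ∈ F, (X.card = 1 ∧ (1 / 2 : ℝ) ^ crossCount G X ≤ x₁) ∨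
      (2 ≤ X.card ∧ (1 / 2 : ℝ) ^ crossCount G X ≤ x ^ X.card) ∨
      (1 / 2 : ℝ) ^ crossCount G X ≤ ε * ((1 / 4) ^ X.card * (3 / 4) ^ crossCount G X)) :
    ∑ X ∈ F, (1 / 2 : ℝ) ^ crossCount G X ≤ n * x₁ + (n * x) ^ 2 + n * ε := by
  let w : Finset (Fin n) → ℝ := fun X => (1 / 4) ^ X.card * (3 / 4) ^ crossCount G X
  have hw : ∀ X, 0 ≤ w X := fun X => by positivity
  have hone : ∀ y : ℝ, ∑ X : Finset (Fin n), (if X.card = 1 then y else 0) = n * y := by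
    intro y
    rw [← sum_filter, sum_const, univ_filter_card_eq, card_powersetCard]
    simp
  have h1 : ∑ X ∈ F, (if X.card = 1 then x₁ else 0) ≤ n * x₁ := by
    rw [← hone]
    exact sum_le_sum_of_subset_of_nonneg (subset_univ _) (by intros; split_ifs <;> simp [hx₁])
  have h2 : ∑ X ∈ F, (if 2 ≤ X.card then x ^ X.card else 0) ≤ (n * x) ^ 2 := by
    have hle : ∑ X ∈ F, (if 2 ≤ X.card then x ^ X.card else 0) ≤
        ∑ X : Finset (Fin n), (if 2 ≤ X.card then x ^ X.card else 0) :=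
      sum_le_sum_of_subset_of_nonneg (subset_univ _)
        (by intros; split_ifs <;> positivity)
    have hsplit : ∑ X : Finset (Fin n), (if 2 ≤ X.card then x ^ X.card else 0) =
        ∑ X : Finset (Fin n), x ^ X.card - 1 - n * x := by
      have hzero : ∑ X : Finset (Fin n), (if X = ∅ then (1 : ℝ) else 0) = 1 := by simp
      rw [← hone x, ← hzero, ← sum_sub_distrib, ← sum_sub_distrib]
      refine sum_congr rfl fun X _ => ?_
      simp only [← card_eq_zero]
      rcases hX : X.card with _ | _ | k <;> simp
    have htot : ∑ X : Finset (Fin n), x ^ X.card = (x + 1) ^ n := by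
      simpa using (Fintype.sum_pow_mul_eq_add_pow (Fin n) x (1 : ℝ))
    have hexp : (x + 1) ^ n ≤ Real.exp (n * x) := by
      rw [Real.exp_nat_mul]
      exact pow_le_pow_left₀ (by positivity) (Real.add_one_le_exp x) n
    have hquad := (le_abs_self _).trans (Real.abs_exp_sub_one_sub_id_le
      (x := n * x) (by rw [abs_of_nonneg (by positivity)]; exact hnx))
    linarith
  have h3 : ∑ X ∈ F, w X ≤ n := by
    calc ∑ X ∈ F, w X ≤ ∑ X ∈ F, ∑ v, if GrowsFrom G {v} X then w X else 0 := by
          refine sum_le_sum fun X hX => ?_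
          obtain ⟨v, hv⟩ := hF X hX
          refine le_trans ?_ (single_le_sum (f := fun v => if GrowsFrom G {v} X then w X else 0)
            (fun v _ => ?_) (mem_univ v))
          · simp [hv]
          · split_ifs
            exacts [hw X, le_rfl]
      _ = ∑ v, ∑ X ∈ F, if GrowsFrom G {v} X then w X else 0 := sum_comm
      _ ≤ ∑ v : Fin n, (1 : ℝ) := by
          refine sum_le_sum fun v _ => ?_
          rw [← sum_filter]
          refine le_trans ?_
            (sum_growsFrom_le_one G (1 / 4) (by norm_num) (by norm_num) {v} ∅)
          refine le_trans (sum_le_sum ?_)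
            (sum_le_sum_of_subset_of_nonneg (s := F.filter fun X => GrowsFrom G {v} X) ?_ ?_)
          · intro X _
            have hc := (card_le_card (sdiff_subset (s := outerBoundary G X) (t := ∅))).trans
              (card_outerBoundary_le G X)
            have e : (1 - 1 / 4 : ℝ) = 3 / 4 := by norm_num
            rw [e]
            exact mul_le_mul
              (pow_le_pow_of_le_one (by norm_num) (by norm_num) (card_le_card sdiff_subset))
              (pow_le_pow_of_le_one (by norm_num) (by norm_num) hc)
              (by positivity) (by positivity)
          · intro X hX
            simp only [mem_filter, mem_univ, true_and] at hX ⊢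
            exact ⟨hX.2, disjoint_empty_right _⟩
          · intros
            norm_num
      _ = n := by simp
  calc ∑ X ∈ F, (1 / 2 : ℝ) ^ crossCount G X
      ≤ ∑ X ∈ F, ((if X.card = 1 then x₁ else 0) + (if 2 ≤ X.card then x ^ X.card else 0) +
        ε * w X) := by
        refine sum_le_sum fun X hX => ?_
        have hεw := mul_nonneg hε (hw X)
        have hA : 0 ≤ if X.card = 1 then x₁ else 0 := by split_ifs <;> simp [hx₁]
        have hB : 0 ≤ if 2 ≤ X.card then x ^ X.card else 0 := by split_ifs <;> positivity
        rcases h X hX with ⟨hc, hle⟩ | ⟨hc, hle⟩ | hle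
        · rw [if_pos hc]
          linarith
        · rw [if_pos hc]
          linarith
        · change _ ≤ ε * w X at hle
          linarith
    _ ≤ _ := by
        rw [sum_add_distrib, sum_add_distrib, ← mul_sum]
        have := mul_le_mul_of_nonneg_left h3 hε
        linarith

theorem half_pow_le_rpow {c : ℕ} {t : ℝ} (h : t ≤ c) : (1 / 2 : ℝ) ^ c ≤ 2 ^ (-t) := by
  rw [one_div, inv_pow, ← Real.rpow_natCast, ← Real.rpow_neg (by norm_num)]
  exact Real.rpow_le_rpow_of_exponent_le (by norm_num) (by linarith)

theorem half_pow_le_of_mul_le {c k m : ℕ} (h : 2 * (m + 2) * k ≤ c) :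
    (1 / 2 : ℝ) ^ c ≤ (1 / 2) ^ (m * k) * ((1 / 4) ^ k * (3 / 4) ^ c) := by
  have h1 : (1 / 2 : ℝ) ^ c = (2 / 3) ^ c * (3 / 4) ^ c := by
    rw [← mul_pow]
    norm_num
  have h2 : (2 / 3 : ℝ) ^ c ≤ (2 / 3) ^ (2 * (m + 2) * k) :=
    pow_le_pow_of_le_one (by norm_num) (by norm_num) h
  have h3 : (2 / 3 : ℝ) ^ (2 * (m + 2) * k) ≤ (1 / 2) ^ ((m + 2) * k) := by
    rw [mul_assoc, pow_mul]
    exact pow_le_pow_left₀ (by norm_num) (by norm_num) _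
  have h4 : (1 / 2 : ℝ) ^ ((m + 2) * k) = (1 / 2) ^ (m * k) * (1 / 4) ^ k := by
    rw [add_mul, pow_add, pow_mul _ 2 k]
    norm_num
  rw [h1, ← mul_assoc]
  exact mul_le_mul_of_nonneg_right ((h2.trans h3).trans h4.le) (by positivity)

/-- A connected set of at most half the total volume has large edge boundary. -/
theorem mul_card_le_crossCount {G : SimpleGraph (Fin n)} [DecidableRel G.Adj] {α ξ L l M : ℝ}
    (hα : 0 < α) (hξ : 4 < ξ) (hL : 0 < L) (hM : 0 ≤ M) (hl : M ≤ 4 * l)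
    (hd : ∀ v, (1 + α) * L ≤ G.degree v) {X : Finset (Fin n)} (hX : X.Nonempty)
    (hvol : vol G X ≤ vol G Xᶜ)
    (hcheeger : X ≠ univ →
      ξ * (l / L) < (crossCount G X : ℝ) / min (vol G X : ℝ) (vol G Xᶜ : ℝ)) :
    M * X.card ≤ crossCount G X := by
  have hk : (0 : ℝ) < X.card := by exact_mod_cast hX.card_pos
  have hv := card_mul_le_vol G hd X
  have hv0 : (0 : ℝ) < vol G X := lt_of_lt_of_le (by positivity) hv
  have hne : X ≠ univ := by
    rintro rfl
    have h0 : 0 < vol G univ := by exact_mod_cast hv0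
    rw [compl_univ] at hvol
    exact absurd (h0.trans_le hvol) (by simp [vol])
  have hc := hcheeger hne
  rw [min_eq_left (by exact_mod_cast hvol), lt_div_iff₀ hv0] at hc
  have hl0 : 0 ≤ l := by linarith
  have hξl : 0 ≤ ξ * (l / L) := by positivity
  have h1 := mul_le_mul_of_nonneg_left hv hξl
  have h2 : ξ * (l / L) * (X.card * ((1 + α) * L)) = ξ * (1 + α) * l * X.card := by
    field_simp
  have h3 : M ≤ ξ * (1 + α) * l := by nlinarith [mul_nonneg hα.le hl0]
  have h4 := mul_le_mul_of_nonneg_right h3 hk.le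
  linarith

open Classical in
theorem sum_half_pow_crossCount_le_rpow {G : SimpleGraph (Fin n)} [DecidableRel G.Adj]
    {α L : ℝ} {m : ℕ} (hα : 0 < α) (hn : (n : ℝ) = 2 ^ L) (hL : 3 ≤ α * L)
    (hm : 3 * (1 + 2 * α) ≤ m * α) (hd : ∀ v, (1 + α) * L ≤ G.degree v)
    {F : Finset (Finset (Fin n))} (hF : ∀ X ∈ F, ∃ v, GrowsFrom G {v} X)
    (hcross : ∀ X ∈ F, 2 * (m + 2) * X.card ≤ crossCount G X) :
    ∑ X ∈ F, (1 / 2 : ℝ) ^ crossCount G X ≤ 2 * 2 ^ (-(α * L)) := by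
  have hL0 : 0 < L := by
    by_contra! h
    nlinarith
  set z : ℝ := 2 ^ (-(α * L / 3)) with hz
  have hz0 : 0 < z := by positivity
  have hz1 : z ≤ 1 / 2 := by
    calc z ≤ 2 ^ (-1 : ℝ) := Real.rpow_le_rpow_of_exponent_le (by norm_num) (by linarith)
      _ = 1 / 2 := by rw [Real.rpow_neg_one]; norm_num
  have hzpow : ∀ j : ℕ, z ^ j = 2 ^ (-(α * L / 3) * j) := fun j => by
    rw [hz, Real.rpow_mul_natCast (by norm_num)]
  have e1 : (n : ℝ) * 2 ^ (-((1 + α) * L)) = z ^ 3 := by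
    rw [hn, ← Real.rpow_add (by norm_num), hzpow]
    congr 1
    push_cast
    ring
  have e2 : (n : ℝ) * 2 ^ (-((1 + 2 * α / 3) * L)) = z ^ 2 := by
    rw [hn, ← Real.rpow_add (by norm_num), hzpow]
    congr 1
    push_cast
    ring
  have e3 : (n : ℝ) * 2 ^ (-((1 + 2 * α) * L)) = z ^ 6 := by
    rw [hn, ← Real.rpow_add (by norm_num), hzpow]
    congr 1
    push_cast
    ring
  have e4 : (2 : ℝ) ^ (-(α * L)) = z ^ 3 := by
    rw [hzpow]
    congr 1
    push_cast
    ring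
  refine (sum_half_pow_crossCount_le G F (2 ^ (-((1 + α) * L))) (2 ^ (-((1 + 2 * α / 3) * L)))
    (2 ^ (-((1 + 2 * α) * L))) (by positivity) (by positivity) (by positivity) ?_ hF ?_).trans ?_
  · rw [e2]
    exact pow_le_one₀ hz0.le (by linarith)
  · intro X hX
    obtain ⟨v, hv, -⟩ := hF X hX
    have hk : 1 ≤ X.card := card_pos.mpr ⟨v, hv (mem_singleton_self v)⟩
    have hdeg := card_mul_le_crossCount_add G hd X
    rcases hk.eq_or_lt with hk1 | hk2
    · refine Or.inl ⟨hk1.symm, half_pow_le_rpow ?_⟩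
      rw [← hk1] at hdeg
      simpa using hdeg
    rcases le_or_gt (X.card : ℝ) (α * L / 3) with hs | hs
    · refine Or.inr (Or.inl ⟨hk2, ?_⟩)
      rw [← Real.rpow_mul_natCast (by norm_num), neg_mul]
      apply half_pow_le_rpow
      have := mul_le_mul_of_nonneg_left hs (Nat.cast_nonneg (α := ℝ) X.card)
      have hk0 : (0 : ℝ) ≤ X.card := Nat.cast_nonneg _
      linarith
    · refine Or.inr (Or.inr ((half_pow_le_of_mul_le (hcross X hX)).trans
        (mul_le_mul_of_nonneg_right (half_pow_le_rpow ?_) (by positivity))))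
      push_cast
      have h1 := mul_le_mul_of_nonneg_left hs.le (Nat.cast_nonneg (α := ℝ) m)
      have h2 := mul_le_mul_of_nonneg_right hm hL0.le
      linarith
  · rw [e1, e2, e3, e4]
    have h3 : 0 < z ^ 3 := by positivity
    have h4 : z ^ 3 * z ≤ z ^ 3 * (1 / 2) := mul_le_mul_of_nonneg_left hz1 h3.le
    have h6 : z ^ 3 * z ^ 3 ≤ z ^ 3 * (1 / 2) :=
      mul_le_mul_of_nonneg_left
        ((pow_le_of_le_one hz0.le (by linarith) (by norm_num)).trans hz1) h3.le
    linarith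

/-- Under the hypotheses of Theorem 1.1, the number of strong orientations of `G`
is at least `(1 − (1 + 4α log₂ n)/(α n^α log₂ n)) · 2^{e(G)}`. -/
theorem many_strong_orientations (α ξ : ℝ) (hα : 0 < α) (hξ : 4 < ξ) :
    ∃ N₀ : ℕ, ∀ n : ℕ, N₀ ≤ n → ∀ (G : SimpleGraph (Fin n)) [DecidableRel G.Adj],
      (∀ v : Fin n, (1 + α) * Real.logb 2 n ≤ (G.degree v : ℝ)) →
      (∀ X : Finset (Fin n), X.Nonempty → X ≠ Finset.univ →
        ξ * (Real.logb 2 (Real.logb 2 n) / Real.logb 2 n) <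
          (crossCount G X : ℝ) / min ((vol G X : ℝ)) ((vol G Xᶜ : ℝ))) →
      (1 - (1 + 4 * α * Real.logb 2 n) / (α * (n : ℝ) ^ α * Real.logb 2 n)) *
          2 ^ G.edgeFinset.card ≤
        (((@Finset.filter _ (fun f : G.edgeSet → Bool => IsStronglyConnected G f)
          (Classical.decPred _) Finset.univ).card : ℝ)) := by
  classical
  obtain ⟨m, hm⟩ := exists_nat_ge (3 * (1 + 2 * α) / α)
  rw [div_le_iff₀ hα] at hm
  have hlog : Filter.Tendsto (fun n : ℕ => Real.logb 2 n) Filter.atTop Filter.atTop :=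
    (Real.tendsto_logb_atTop (by norm_num)).comp tendsto_natCast_atTop_atTop
  have hloglog := (Real.tendsto_logb_atTop (b := 2) (by norm_num)).comp hlog
  obtain ⟨N, hN⟩ := Filter.eventually_atTop.mp
    ((hlog.eventually_ge_atTop (3 / α)).and
      (hloglog.eventually_ge_atTop ((2 * (m + 2) : ℕ) / 4 : ℝ)))
  refine ⟨N, fun n hn G _ hdeg hcheeger => ?_⟩
  obtain ⟨hL, hl⟩ := hN n hn
  simp only [Function.comp_apply] at hl
  have hL0 : 0 < Real.logb 2 n := lt_of_lt_of_le (by positivity) hL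
  rw [div_le_iff₀' hα] at hL
  have hn0 : (0 : ℝ) < n := by
    rcases Nat.eq_zero_or_pos n with rfl | h
    · simp at hL0
    · exact_mod_cast h
  have hn2 : (n : ℝ) = 2 ^ Real.logb 2 n :=
    (Real.rpow_logb (by norm_num) (by norm_num) hn0).symm
  have hnα : (n : ℝ) ^ α = 2 ^ (α * Real.logb 2 n) := by
    nth_rewrite 1 [hn2]
    rw [← Real.rpow_mul (by norm_num), mul_comm]
  have hnα0 : 0 < (n : ℝ) ^ α := by positivity
  have hsum := sum_half_pow_crossCount_le_rpow
    (F := univ.filter fun X => vol G X ≤ vol G Xᶜ ∧ ∃ v, GrowsFrom G {v} X) hα hn2 hL hm hdeg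
    (fun X hX => (mem_filter.mp hX).2.2) (fun X hX => by
      obtain ⟨hvol, v, hv, -⟩ := (mem_filter.mp hX).2
      have hX0 : X.Nonempty := ⟨v, hv (mem_singleton_self v)⟩
      have := mul_card_le_crossCount (M := (2 * (m + 2) : ℕ)) hα hξ hL0 (by positivity)
        (by linarith) hdeg hX0 hvol (hcheeger X hX0)
      exact_mod_cast this)
  have hbad := card_not_stronglyConnected_le G
  have hcount := card_filter_add_card_filter_not (s := (univ : Finset (G.edgeSet → Bool)))
    (fun f => IsStronglyConnected G f)
  have hcard : (univ : Finset (G.edgeSet → Bool)).card = 2 ^ G.edgeFinset.card := by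
    simp [SimpleGraph.edgeFinset_card]
  rw [hcard] at hcount
  have hcount' : ((univ.filter fun f : G.edgeSet → Bool => IsStronglyConnected G f).card : ℝ) +
      (univ.filter fun f : G.edgeSet → Bool => ¬ IsStronglyConnected G f).card =
        2 ^ G.edgeFinset.card := by
    exact_mod_cast hcount
  have hε : 4 * (2 : ℝ) ^ (-(α * Real.logb 2 n)) ≤
      (1 + 4 * α * Real.logb 2 n) / (α * (n : ℝ) ^ α * Real.logb 2 n) := by
    rw [Real.rpow_neg (by norm_num), ← hnα, ← div_eq_mul_inv, div_le_div_iff₀ hnα0 (by positivity)]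
    linarith
  have hpow : (0 : ℝ) ≤ 2 ^ G.edgeFinset.card := by positivity
  have hb := hbad.trans (mul_le_mul_of_nonneg_left (mul_le_mul_of_nonneg_left hsum
    (by norm_num : (0 : ℝ) ≤ 2)) hpow)
  have hε' := mul_le_mul_of_nonneg_left hε hpow
  have hgoal : (1 - (1 + 4 * α * Real.logb 2 n) / (α * (n : ℝ) ^ α * Real.logb 2 n)) *
      2 ^ G.edgeFinset.card ≤
        ((univ.filter fun f : G.edgeSet → Bool => IsStronglyConnected G f).card : ℝ) := by
    linarith
  convert hgoal
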